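/- Let K ≥ 1 and let M ≥ 1, N ≥ 1 be integers, and consider the homogeneous configuration where every one of the K receivers has N antennas and every one of the K transmitters has M antennas. Then the proper condition holds — that is, for every pair of subsets S_RX, S_TX ⊆ Fin K one has |S_RX|(N − 1) + |S_TX|(M − 1) ≥ |{(i,j) : i ∈ S_RX, j ∈ S_TX, i ≠ j}| — if and only if M + N ≥ K + 1. -/

import Mathlib

open Finset

/-- Number of IA equations stemming from the subset of RXs `SRX` and TXs `STX`. -/
def NEq {K : ℕ} (SRX STX : Finset (Fin K)) : ℤ :=
  (((SRX ×ˢ STX).filter fun p => p.1 ≠ p.2).card : ℤ)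

theorem NEq_eq_sum_card_erase {K : ℕ} (SRX STX : Finset (Fin K)) :
    NEq SRX STX = ∑ i ∈ SRX, ((STX.erase i).card : ℤ) := by
  have h (i : Fin K) : STX.erase i = STX.filter fun j => i ≠ j := by
    ext j
    simp only [mem_erase, mem_filter, ne_comm, and_comm]
  simp only [NEq, h, card_filter, sum_product, Nat.cast_sum]

theorem NEq_comm {K : ℕ} (SRX STX : Finset (Fin K)) : NEq SRX STX = NEq STX SRX := by
  simp only [NEq, card_filter]
  rw [sum_product, sum_product_right]
  simp only [ne_comm]

theorem NEq_univ (K : ℕ) : NEq (univ : Finset (Fin K)) univ = K * ((K : ℤ) - 1) := by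
  rw [NEq_eq_sum_card_erase]
  cases K <;> simp

/-- Each receiver meets at most `K - 1` interfering transmitters. -/
theorem NEq_le_card_left_mul {K : ℕ} (SRX STX : Finset (Fin K)) :
    NEq SRX STX ≤ SRX.card * ((K : ℤ) - 1) := by
  rw [NEq_eq_sum_card_erase, ← nsmul_eq_mul]
  refine sum_le_card_nsmul _ _ _ fun i _ => ?_
  have h := card_le_card (erase_subset_erase i (subset_univ STX))
  rw [card_erase_of_mem (mem_univ i), card_univ, Fintype.card_fin] at h
  have := i.pos
  omega

theorem NEq_le_card_right_mul {K : ℕ} (SRX STX : Finset (Fin K)) :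
    NEq SRX STX ≤ STX.card * ((K : ℤ) - 1) :=
  NEq_comm SRX STX ▸ NEq_le_card_left_mul STX SRX

/-- In the homogeneous `[(N,M)^K]` IC, the proper condition reduces to `M + N ≥ K + 1`. -/
theorem homogeneous_proper_iff (K : ℕ) (hK : 1 ≤ K) (M N : ℤ) (hM : 1 ≤ M) (hN : 1 ≤ N) :
    (∀ SRX STX : Finset (Fin K),
        (SRX.card : ℤ) * (N - 1) + (STX.card : ℤ) * (M - 1) ≥ NEq SRX STX) ↔
    M + N ≥ (K : ℤ) + 1 := by
  constructor
  · intro h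
    have h := h univ univ
    rw [NEq_univ, card_univ, Fintype.card_fin, ← mul_add] at h
    have := le_of_mul_le_mul_left h (by exact_mod_cast hK)
    linarith
  · intro h SRX STX
    have hl := NEq_le_card_left_mul SRX STX
    have hr := NEq_le_card_right_mul SRX STX
    rcases le_total (SRX.card : ℤ) STX.card with hc | hc
    · nlinarith [mul_nonneg (sub_nonneg.2 hc) (sub_nonneg.2 hM),
        mul_nonneg (Nat.cast_nonneg (α := ℤ) SRX.card) (sub_nonneg.2 h)]
    · nlinarith [mul_nonneg (sub_nonneg.2 hc) (sub_nonneg.2 hN),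
        mul_nonneg (Nat.cast_nonneg (α := ℤ) STX.card) (sub_nonneg.2 h)]
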